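/- Let f : ℕ → ℕ be such that for every n, every simple 2-CNF formula with at most n variables has a 2-CNF encoding with at most f(n) clauses. Then there exists a constant C such that for every n, every 2-CNF formula with at most n variables has a 2-CNF encoding with at most f(n) + C·n clauses. -/

import Mathlib

namespace BVAPaper

/-- A literal is a propositional variable (a natural number) together with a
polarity: `true` for a positive literal, `false` for a negative one. -/
abbrev Lit := ℕ × Bool

/-- A clause is a finite set of literals (required to be pairwise
non-complementary via `IsClause`). -/
abbrev Clause := Finset Lit

/-- A formula is a finite set of clauses; its size is its number of clauses. -/
abbrev Formula := Finset Clause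

/-- A genuine clause: it contains no pair of complementary literals. -/
def IsClause (C : Clause) : Prop := ∀ v : ℕ, ¬ ((v, true) ∈ C ∧ (v, false) ∈ C)

/-- A 2-CNF formula: every member is a genuine clause with exactly two literals. -/
def Is2CNF (φ : Formula) : Prop := ∀ C ∈ φ, IsClause C ∧ C.card = 2

/-- The set of variables occurring in a formula. -/
def Vars (φ : Formula) : Finset ℕ := φ.biUnion (fun C => C.image Prod.fst)

/-- A literal is true under an assignment. -/
def LitTrue (τ : ℕ → Bool) (l : Lit) : Prop := τ l.1 = l.2

/-- An assignment satisfies a formula if it makes some literal of every clause true. -/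
def Satisfies (τ : ℕ → Bool) (φ : Formula) : Prop := ∀ C ∈ φ, ∃ l ∈ C, LitTrue τ l

/-- `φ` semantically implies the equivalence of the literals `l₁` and `l₂`. -/
def ImpliesEquiv (φ : Formula) (l₁ l₂ : Lit) : Prop :=
  ∀ τ : ℕ → Bool, Satisfies τ φ → (LitTrue τ l₁ ↔ LitTrue τ l₂)

/-- A simple 2-CNF formula: (a) no two distinct literals are implied equivalent,
(b) every clause contains a negative literal, (c) no two distinct clauses are over
the same pair of variables. -/
def IsSimple (φ : Formula) : Prop :=
  (∀ l₁ l₂ : Lit, l₁ ≠ l₂ → ¬ ImpliesEquiv φ l₁ l₂) ∧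
  (∀ C ∈ φ, ∃ l ∈ C, l.2 = false) ∧
  (∀ C₁ ∈ φ, ∀ C₂ ∈ φ, C₁.image Prod.fst = C₂.image Prod.fst → C₁ = C₂)

/-- A monotone formula: every literal occurring in it is positive. -/
def MonotoneFormula (φ : Formula) : Prop := ∀ C ∈ φ, ∀ l ∈ C, l.2 = true

/-- `𝒞 ⋈ 𝒟`: the set of clauses `C ∪ D` for `C ∈ 𝒞` and `D ∈ 𝒟`. -/
def JoinClauses (𝒞 𝒟 : Finset Clause) : Finset Clause :=
  (𝒞 ×ˢ 𝒟).image (fun p => p.1 ∪ p.2)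

/-- One BVA step. -/
def BVAStep (φ φ' : Formula) : Prop :=
  ∃ (𝒞 𝒟 : Finset Clause) (y : ℕ),
    (∀ C ∈ 𝒞, IsClause C ∧ C.Nonempty) ∧
    (∀ D ∈ 𝒟, IsClause D ∧ D.Nonempty) ∧
    JoinClauses 𝒞 𝒟 ⊆ φ ∧
    y ∉ Vars φ ∧
    φ' = (φ \ JoinClauses 𝒞 𝒟)
      ∪ 𝒞.image (fun C => insert ((y, true) : Lit) C)
      ∪ 𝒟.image (fun D => insert ((y, false) : Lit) D)

/-- Idealized BVA: the reflexive transitive closure of single BVA steps. -/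
def BVAChain : Formula → Formula → Prop := Relation.ReflTransGen BVAStep

/-- Negate the variables from `S` inside a literal. -/
def flipLit (S : Finset ℕ) (l : Lit) : Lit := if l.1 ∈ S then (l.1, !l.2) else l

/-- Negate the variables from `S` throughout a formula. -/
def flipFormula (S : Finset ℕ) (φ : Formula) : Formula :=
  φ.image (fun C => C.image (flipLit S))

/-- `φ ≅_W φ'`: `φ'` is obtained from `φ` by replacing some variables from `W`
by their negations wherever they appear. -/
def EquivW (W : Finset ℕ) (φ φ' : Formula) : Prop :=
  ∃ S ⊆ W, φ' = flipFormula S φ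

/-- `φ'` encodes `φ` over the base variables `X`: for every assignment `τ` of `X`,
`τ` satisfies `φ` iff `τ` extends to a satisfying assignment of `φ'`. -/
def Encodes (φ' φ : Formula) (X : Finset ℕ) : Prop :=
  ∀ τ : ℕ → Bool,
    Satisfies τ φ ↔ ∃ σ : ℕ → Bool, (∀ x ∈ X, σ x = τ x) ∧ Satisfies σ φ'

/-- The direct encoding of the at-most-one constraint on the variables `0, …, n-1`. -/
def atMostOne (n : ℕ) : Formula :=
  (((Finset.range n) ×ˢ (Finset.range n)).filter (fun p => p.1 < p.2)).image
    (fun p => ({(p.1, false), (p.2, false)} : Clause))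

/-- A diagram: a graph with both undirected edges (represented as a symmetric
set of ordered pairs) and directed edges. -/
structure Diagram where
  verts : Finset ℕ
  undir : Finset (ℕ × ℕ)
  dir : Finset (ℕ × ℕ)

/-- Well-formedness of a diagram: no loops, edges between vertices, the
undirected edge set is symmetric, and at most one edge between any two vertices. -/
def Diagram.WF (G : Diagram) : Prop :=
  (∀ e ∈ G.undir, e.1 ∈ G.verts ∧ e.2 ∈ G.verts ∧ e.1 ≠ e.2) ∧
  (∀ e ∈ G.dir, e.1 ∈ G.verts ∧ e.2 ∈ G.verts ∧ e.1 ≠ e.2) ∧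
  (∀ u v : ℕ, (u, v) ∈ G.undir → (v, u) ∈ G.undir) ∧
  (∀ u v : ℕ, (u, v) ∈ G.undir → (u, v) ∉ G.dir ∧ (v, u) ∉ G.dir) ∧
  (∀ u v : ℕ, (u, v) ∈ G.dir → (v, u) ∉ G.dir)

/-- The complete diagram `K_n` on vertices `0, …, n-1`: all edges undirected. -/
def completeDiagram (n : ℕ) : Diagram where
  verts := Finset.range n
  undir := ((Finset.range n) ×ˢ (Finset.range n)).filter (fun p => p.1 ≠ p.2)
  dir := ∅

/-- The diagram associated to a simple 2-CNF formula: an undirected edge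
`{x, y}` for each clause `(¬x ∨ ¬y)` and a directed edge `(x, y)` for each
clause `(¬x ∨ y)`. -/
def diagramOf (φ : Formula) : Diagram where
  verts := Vars φ
  undir := ((Vars φ) ×ˢ (Vars φ)).filter
    (fun p => ({(p.1, false), (p.2, false)} : Clause) ∈ φ)
  dir := ((Vars φ) ×ˢ (Vars φ)).filter
    (fun p => ({(p.1, false), (p.2, true)} : Clause) ∈ φ)

/-- A polarized diagram: a directed graph with a polarity on its edges
(`true` = `+`, `false` = `−`). -/
structure PolDiagram where
  verts : Finset ℕ
  edges : Finset (ℕ × ℕ)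
  pol : ℕ × ℕ → Bool

/-- `(P, P.pol)` is a polarized diagram of the diagram `G`: every undirected
edge of `G` is oriented (in exactly one way) with polarity `−`, and every
directed edge of `G` is kept with polarity `+`. -/
def IsPolarizationOf (P : PolDiagram) (G : Diagram) : Prop :=
  P.verts = G.verts ∧
  (∀ u v : ℕ, (u, v) ∈ G.dir ↔ ((u, v) ∈ P.edges ∧ P.pol (u, v) = true)) ∧
  (∀ u v : ℕ, (u, v) ∈ G.undir ↔
    (((u, v) ∈ P.edges ∧ P.pol (u, v) = false) ∨
     ((v, u) ∈ P.edges ∧ P.pol (v, u) = false))) ∧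
  (∀ u v : ℕ, ¬ ((u, v) ∈ P.edges ∧ (v, u) ∈ P.edges))

/-- A polarized rectifier network: base vertices, auxiliary vertices, directed
edges, and a polarity function (only meaningful on edges into base vertices). -/
structure PRN where
  base : Finset ℕ
  aux : Finset ℕ
  edges : Finset (ℕ × ℕ)
  pol : ℕ × ℕ → Bool

/-- Well-formedness of a PRN: base and auxiliary vertices are disjoint, and
edges are loopless edges between vertices. -/
def PRN.WF (R : PRN) : Prop :=
  Disjoint R.base R.aux ∧
  (∀ e ∈ R.edges, e.1 ∈ R.base ∪ R.aux ∧ e.2 ∈ R.base ∪ R.aux ∧ e.1 ≠ e.2)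

/-- A valid walk from the base vertex `u` to the base vertex `v`: a sequence of
length ≥ 2 of consecutive edges whose interior vertices are auxiliary. -/
def ValidWalk (R : PRN) (u v : ℕ) (π : List ℕ) : Prop :=
  2 ≤ π.length ∧
  π.head? = some u ∧ π.getLast? = some v ∧
  u ∈ R.base ∧ v ∈ R.base ∧
  List.Chain' (fun a b => (a, b) ∈ R.edges) π ∧
  (∀ i : ℕ, 0 < i → i + 1 < π.length → π.getD i 0 ∈ R.aux)

/-- The polarity of a walk: the polarity of its last edge. -/
def walkPol (R : PRN) (π : List ℕ) : Bool :=
  R.pol (π.getD (π.length - 2) 0, π.getD (π.length - 1) 0)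

/-- A strict polarized rectifier network: (1) for distinct base vertices `u, v`
there is at most one valid walk from `u` to `v` or from `v` to `u` in total, and
(2) every auxiliary vertex belongs to some valid walk. -/
def IsSPRN (R : PRN) : Prop :=
  (∀ u ∈ R.base, ∀ v ∈ R.base, u ≠ v →
    ∀ π₁ π₂ : List ℕ,
      (ValidWalk R u v π₁ ∨ ValidWalk R v u π₁) →
      (ValidWalk R u v π₂ ∨ ValidWalk R v u π₂) → π₁ = π₂) ∧
  (∀ a ∈ R.aux, ∃ u v : ℕ, ∃ π : List ℕ, ValidWalk R u v π ∧ a ∈ π)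

/-- The PRN `R` realizes the polarized diagram `P`. -/
def RealizesPol (R : PRN) (P : PolDiagram) : Prop :=
  R.base = P.verts ∧
  ∀ u ∈ P.verts, ∀ v ∈ P.verts,
    ((u, v) ∈ P.edges ↔ ∃ π : List ℕ, ValidWalk R u v π ∧ walkPol R π = P.pol (u, v))

/-- The PRN `R` realizes the diagram `G`: it realizes some polarized diagram of `G`. -/
def RealizesDiagram (R : PRN) (G : Diagram) : Prop :=
  ∃ P : PolDiagram, IsPolarizationOf P G ∧ RealizesPol R P

/-- The 2-CNF formula `F_R` associated to a PRN `R`. -/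
def PRN.formula (R : PRN) : Formula :=
  R.edges.image (fun e =>
    if e.2 ∈ R.base ∧ R.pol e = false
    then ({(e.1, false), (e.2, false)} : Clause)
    else ({(e.1, false), (e.2, true)} : Clause))

/-- The PRN associated to a polarized diagram (no auxiliary vertices). -/
def prnOfPol (P : PolDiagram) : PRN :=
  ⟨P.verts, ∅, P.edges, P.pol⟩

/-- A coherent biclique `(X, Y)` of a PRN. -/
def CoherentBiclique (R : PRN) (X Y : Finset ℕ) : Prop :=
  X.Nonempty ∧ Y.Nonempty ∧ Disjoint X Y ∧
  X ⊆ R.base ∪ R.aux ∧ Y ⊆ R.base ∪ R.aux ∧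
  (∀ x ∈ X, ∀ y ∈ Y, (x, y) ∈ R.edges) ∧
  (∀ y ∈ Y, y ∈ R.base → ∀ x₁ ∈ X, ∀ x₂ ∈ X, R.pol (x₁, y) = R.pol (x₂, y))

/-- `R'` is the biclique reduction of `R` with respect to some coherent biclique. -/
def BicliqueStep (R R' : PRN) : Prop :=
  ∃ (X Y : Finset ℕ) (z : ℕ),
    CoherentBiclique R X Y ∧
    z ∉ R.base ∪ R.aux ∧
    R'.base = R.base ∧
    R'.aux = insert z R.aux ∧
    R'.edges = (R.edges \ (X ×ˢ Y)) ∪ (X ×ˢ ({z} : Finset ℕ)) ∪ (({z} : Finset ℕ) ×ˢ Y) ∧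
    (∀ y ∈ Y, y ∈ R.base → ∀ x ∈ X, R'.pol (z, y) = R.pol (x, y)) ∧
    (∀ e ∈ R.edges \ (X ×ˢ Y), e.2 ∈ R.base → R'.pol e = R.pol e)

/-- `R ↪* R'`: the reflexive transitive closure of biclique reduction. -/
def BicliqueChain : PRN → PRN → Prop := Relation.ReflTransGen BicliqueStep

/-- The total degree (in-degree plus out-degree) of a vertex in a PRN. -/
def totalDeg (R : PRN) (v : ℕ) : ℕ :=
  (R.edges.filter (fun e => e.1 = v)).card + (R.edges.filter (fun e => e.2 = v)).card

lemma isClause_and_card_eq_two_iff {C : Clause} :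
    IsClause C ∧ C.card = 2 ↔ ∃ v w b c, v ≠ w ∧ C = {((v, b) : Lit), (w, c)} := by
  constructor
  · rintro ⟨hC, hcard⟩
    obtain ⟨⟨v, b⟩, ⟨w, c⟩, hne, rfl⟩ := Finset.card_eq_two.1 hcard
    refine ⟨v, w, b, c, ?_, rfl⟩
    rintro rfl
    apply hC v
    cases b <;> cases c <;> simp_all
  · rintro ⟨v, w, b, c, hne, rfl⟩
    refine ⟨?_, Finset.card_pair (by simp [hne])⟩
    intro x hx
    simp only [Finset.mem_insert, Finset.mem_singleton, Prod.mk.injEq] at hx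
    grind

lemma exists_mem_pair_litTrue {τ : ℕ → Bool} {v w : ℕ} {b c : Bool} :
    (∃ l ∈ ({((v, b) : Lit), (w, c)} : Clause), LitTrue τ l) ↔ τ v = b ∨ τ w = c := by
  simp [LitTrue]

lemma mem_Vars {φ : Formula} {C : Clause} {l : Lit} (hC : C ∈ φ) (hl : l ∈ C) :
    l.1 ∈ Vars φ :=
  Finset.mem_biUnion.2 ⟨C, hC, Finset.mem_image_of_mem _ hl⟩

/-- Satisfaction depends only on the variables occurring in the formula. -/
lemma Satisfies.congr {φ : Formula} {σ τ : ℕ → Bool} (hσ : Satisfies σ φ)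
    (h : ∀ x ∈ Vars φ, σ x = τ x) : Satisfies τ φ := by
  intro C hC
  obtain ⟨l, hl, hlt⟩ := hσ C hC
  exact ⟨l, hl, (h _ (mem_Vars hC hl)).symm.trans hlt⟩

/-- Rename the variable of a literal by `g`, negating it where `s` is true. -/
def mapLit (g : ℕ → ℕ) (s : ℕ → Bool) (l : Lit) : Lit := (g l.1, xor l.2 (s l.1))

/-- Apply `mapLit` throughout a formula. -/
def mapFormula (g : ℕ → ℕ) (s : ℕ → Bool) (φ : Formula) : Formula :=
  φ.image (fun C => C.image (mapLit g s))

lemma satisfies_mapFormula {g : ℕ → ℕ} {s σ : ℕ → Bool} {φ : Formula} :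
    Satisfies σ (mapFormula g s φ) ↔ Satisfies (fun v => xor (σ (g v)) (s v)) φ := by
  have key : ∀ l : Lit, LitTrue σ (mapLit g s l) ↔
      LitTrue (fun v => xor (σ (g v)) (s v)) l := by
    rintro ⟨v, b⟩
    simp only [LitTrue, mapLit]
    cases σ (g v) <;> cases s v <;> cases b <;> simp
  simp only [Satisfies, mapFormula, Finset.forall_mem_image, Finset.exists_mem_image, key]

lemma Is2CNF.mapFormula {g : ℕ → ℕ} (hg : Function.Injective g) (s : ℕ → Bool)
    {φ : Formula} (hφ : Is2CNF φ) : Is2CNF (mapFormula g s φ) := by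
  intro C hC
  obtain ⟨D, hD, rfl⟩ := Finset.mem_image.1 hC
  obtain ⟨v, w, b, c, hne, rfl⟩ := isClause_and_card_eq_two_iff.1 (hφ D hD)
  refine isClause_and_card_eq_two_iff.2 ⟨g v, g w, xor b (s v), xor c (s w), hg.ne hne, ?_⟩
  rw [Finset.image_insert, Finset.image_singleton]
  rfl

lemma Is2CNF.union {φ ψ : Formula} (hφ : Is2CNF φ) (hψ : Is2CNF ψ) : Is2CNF (φ ∪ ψ) :=
  fun C hC => (Finset.mem_union.1 hC).elim (hφ C) (hψ C)

lemma satisfies_union {σ : ℕ → Bool} {φ ψ : Formula} :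
    Satisfies σ (φ ∪ ψ) ↔ Satisfies σ φ ∧ Satisfies σ ψ := by
  simp only [Satisfies, Finset.mem_union, or_imp, forall_and]

/-- `φ` forces the variable `x` to take its value under `τ₀`. -/
def Forced (φ : Formula) (τ₀ : ℕ → Bool) (x : ℕ) : Prop :=
  ∀ τ, Satisfies τ φ → τ x = τ₀ x

/-- In every model of `φ`, the variables `x` and `y` either both agree or both
disagree with `τ₀`. -/
def Tied (φ : Formula) (τ₀ : ℕ → Bool) (x y : ℕ) : Prop :=
  ∀ τ, Satisfies τ φ → xor (τ x) (τ₀ x) = xor (τ y) (τ₀ y)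

/-- The least variable of `φ` tied to `x`. -/
noncomputable def rep (φ : Formula) (τ₀ : ℕ → Bool) (x : ℕ) : ℕ :=
  sInf {y | y ∈ Vars φ ∧ Tied φ τ₀ x y}

section Reduction

variable {φ : Formula} {τ₀ : ℕ → Bool}

lemma rep_spec {x : ℕ} (hx : x ∈ Vars φ) :
    rep φ τ₀ x ∈ Vars φ ∧ Tied φ τ₀ x (rep φ τ₀ x) :=
  Nat.sInf_mem (s := {y | y ∈ Vars φ ∧ Tied φ τ₀ x y}) ⟨x, hx, fun _ _ => rfl⟩

lemma Tied.rep_eq {x y : ℕ} (h : Tied φ τ₀ x y) : rep φ τ₀ x = rep φ τ₀ y := by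
  unfold rep
  congr 1
  ext z
  exact and_congr_right fun _ =>
    ⟨fun hz τ hτ => (h τ hτ).symm.trans (hz τ hτ), fun hz τ hτ => (h τ hτ).trans (hz τ hτ)⟩

lemma Tied.forced {x y : ℕ} (h : Tied φ τ₀ x y) (hy : Forced φ τ₀ y) : Forced φ τ₀ x := by
  intro τ hτ
  have := h τ hτ
  rw [hy τ hτ] at this
  simpa using this

open Classical in
/-- Discard the clauses of `φ` with a forced variable, replace every literal by its
representative with polarity relative to `τ₀`, and discard the clauses that degenerate. -/
noncomputable def reduced (φ : Formula) (τ₀ : ℕ → Bool) : Formula :=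
  (mapFormula (rep φ τ₀) τ₀ (φ.filter fun C => ∀ l ∈ C, ¬ Forced φ τ₀ l.1)).filter
    fun C => IsClause C ∧ C.card = 2

lemma is2CNF_reduced : Is2CNF (reduced φ τ₀) := by
  classical
  exact fun C hC => (Finset.mem_filter.1 hC).2

lemma exists_of_mem_Vars_reduced {u : ℕ} (hu : u ∈ Vars (reduced φ τ₀)) :
    ∃ x ∈ Vars φ, ¬ Forced φ τ₀ x ∧ rep φ τ₀ x = u := by
  classical
  obtain ⟨C, hC, hu⟩ := Finset.mem_biUnion.1 hu
  obtain ⟨l, hl, rfl⟩ := Finset.mem_image.1 hu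
  obtain ⟨D, hD, rfl⟩ := Finset.mem_image.1 (Finset.mem_filter.1 hC).1
  obtain ⟨m, hm, rfl⟩ := Finset.mem_image.1 hl
  obtain ⟨hD, hf⟩ := Finset.mem_filter.1 hD
  exact ⟨m.1, mem_Vars hD hm, hf m hm, rfl⟩

lemma mem_Vars_of_mem_Vars_reduced {u : ℕ} (hu : u ∈ Vars (reduced φ τ₀)) :
    u ∈ Vars φ ∧ ¬ Forced φ τ₀ u ∧ rep φ τ₀ u = u := by
  obtain ⟨x, hx, hf, rfl⟩ := exists_of_mem_Vars_reduced hu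
  obtain ⟨hr, ht⟩ := rep_spec (τ₀ := τ₀) hx
  exact ⟨hr, fun h => hf (ht.forced h), ht.rep_eq.symm⟩

lemma Satisfies.reduced {τ : ℕ → Bool} (hτ : Satisfies τ φ) :
    Satisfies (fun v => xor (τ v) (τ₀ v)) (reduced φ τ₀) := by
  classical
  have h : Satisfies (fun v => xor (τ v) (τ₀ v))
      (mapFormula (rep φ τ₀) τ₀ (φ.filter fun C => ∀ l ∈ C, ¬ Forced φ τ₀ l.1)) := by
    rw [satisfies_mapFormula]
    intro C hC
    have hC := (Finset.mem_filter.1 hC).1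
    obtain ⟨l, hl, hlt⟩ := hτ C hC
    refine ⟨l, hl, ?_⟩
    have := (rep_spec (τ₀ := τ₀) (mem_Vars hC hl)).2 τ hτ
    simpa only [LitTrue, ← this, Bool.xor_assoc, Bool.xor_self, Bool.xor_false] using hlt
  exact fun C hC => h C (Finset.mem_filter.1 hC).1

lemma satisfies_reduced_false (hτ₀ : Satisfies τ₀ φ) :
    Satisfies (fun _ => false) (reduced φ τ₀) := by
  simpa using hτ₀.reduced (τ₀ := τ₀)

lemma mem_Vars_reduced_of_eq (hτ₀ : Satisfies τ₀ φ) {u v : ℕ} (huv : u ≠ v)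
    (h : ∀ τ, Satisfies τ (reduced φ τ₀) → τ u = τ v) : u ∈ Vars (reduced φ τ₀) := by
  by_contra hu
  have := h (Function.update (fun _ => false) u true)
    ((satisfies_reduced_false hτ₀).congr fun x hx => by
      rw [Function.update_of_ne (by rintro rfl; exact hu hx)])
  simp [huv.symm] at this

lemma eq_of_reduced_implies_eq (hτ₀ : Satisfies τ₀ φ) {u v : ℕ}
    (h : ∀ τ, Satisfies τ (reduced φ τ₀) → τ u = τ v) : u = v := by
  by_contra huv
  have hu := mem_Vars_of_mem_Vars_reduced (mem_Vars_reduced_of_eq hτ₀ huv h)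
  have hv := mem_Vars_of_mem_Vars_reduced
    (mem_Vars_reduced_of_eq hτ₀ (Ne.symm huv) fun τ hτ => (h τ hτ).symm)
  have ht : Tied φ τ₀ u v := fun τ hτ => h _ hτ.reduced
  exact huv (hu.2.2.symm.trans (ht.rep_eq.trans hv.2.2))

lemma exists_reduced_eq_true {u : ℕ} (hu : u ∈ Vars (reduced φ τ₀)) :
    ∃ τ, Satisfies τ (reduced φ τ₀) ∧ τ u = true := by
  by_contra! h
  refine (mem_Vars_of_mem_Vars_reduced hu).2.1 fun τ hτ => ?_
  simpa using h _ hτ.reduced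

lemma isSimple_reduced (hτ₀ : Satisfies τ₀ φ) : IsSimple (reduced φ τ₀) := by
  have hfalse := satisfies_reduced_false hτ₀
  refine ⟨?_, ?_, ?_⟩
  · rintro ⟨u, b⟩ ⟨v, c⟩ hne h
    have hbc : b = c := by
      have := h _ hfalse
      simp only [LitTrue] at this
      cases b <;> cases c <;> simp_all
    subst hbc
    refine hne (congrArg (·, b) (eq_of_reduced_implies_eq hτ₀ fun τ hτ => ?_))
    have := h τ hτ
    simp only [LitTrue] at this
    cases b <;> cases hu : τ u <;> cases hv : τ v <;> simp_all
  · intro C hC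
    obtain ⟨l, hl, h⟩ := hfalse C hC
    exact ⟨l, hl, h.symm⟩
  · intro C₁ h₁ C₂ h₂ hC
    have s₁ := fun τ (hτ : Satisfies τ (reduced φ τ₀)) => hτ C₁ h₁
    have s₂ := fun τ (hτ : Satisfies τ (reduced φ τ₀)) => hτ C₂ h₂
    obtain ⟨u, v, b, c, huv, rfl⟩ := isClause_and_card_eq_two_iff.1 (is2CNF_reduced C₁ h₁)
    obtain ⟨b', c', rfl⟩ : ∃ b' c', C₂ = {((u, b') : Lit), (v, c')} := by
      obtain ⟨u', v', b', c', huv', rfl⟩ :=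
        isClause_and_card_eq_two_iff.1 (is2CNF_reduced C₂ h₂)
      simp only [Finset.image_insert, Finset.image_singleton] at hC
      have hu : u' = u ∨ u' = v := by
        have : u' ∈ ({u, v} : Finset ℕ) := by simp [hC]
        simpa using this
      have hv : v' = u ∨ v' = v := by
        have : v' ∈ ({u, v} : Finset ℕ) := by simp [hC]
        simpa using this
      rcases hu with rfl | rfl <;> rcases hv with rfl | rfl
      · exact absurd rfl huv'
      · exact ⟨b', c', rfl⟩
      · exact ⟨c', b', Finset.pair_comm _ _⟩
      · exact absurd rfl huv'
    simp only [exists_mem_pair_litTrue] at s₁ s₂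
    have hu : u ∈ Vars (reduced φ τ₀) :=
      mem_Vars h₁ (Finset.mem_insert_self ((u, b) : Lit) _)
    have hv : v ∈ Vars (reduced φ τ₀) :=
      mem_Vars h₁ (Finset.mem_insert_of_mem (Finset.mem_singleton_self ((v, c) : Lit)))
    obtain ⟨τu, hτu, hu⟩ := exists_reduced_eq_true hu
    obtain ⟨τv, hτv, hv⟩ := exists_reduced_eq_true hv
    obtain ⟨τ, hτ, hne⟩ : ∃ τ, Satisfies τ (reduced φ τ₀) ∧ τ u ≠ τ v := by
      by_contra! h
      exact huv (eq_of_reduced_implies_eq hτ₀ h)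
    have e₁ := s₁ _ hfalse
    have e₂ := s₂ _ hfalse
    have a₁ := s₁ _ hτu
    have a₂ := s₂ _ hτu
    have b₁ := s₁ _ hτv
    have b₂ := s₂ _ hτv
    have c₁ := s₁ _ hτ
    have c₂ := s₂ _ hτ
    grind

lemma card_Vars_reduced_le : (Vars (reduced φ τ₀)).card ≤ (Vars φ).card :=
  Finset.card_le_card fun _ hu => (mem_Vars_of_mem_Vars_reduced hu).1

open Classical in
/-- Clauses fixing the forced variables of `φ` to their values under `τ₀` and defining the
other ones from the copies, shifted by `N`, of their representatives. -/
noncomputable def linking (φ : Formula) (τ₀ : ℕ → Bool) (N : ℕ) : Formula :=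
  (Vars φ).biUnion fun x =>
    if Forced φ τ₀ x then {{(x, τ₀ x), (x + N, true)}, {(x, τ₀ x), (x + N, false)}}
    else {{(x, τ₀ x), (rep φ τ₀ x + N, true)}, {(x, !τ₀ x), (rep φ τ₀ x + N, false)}}

lemma card_linking_le (N : ℕ) : (linking φ τ₀ N).card ≤ (Vars φ).card * 2 := by
  classical
  refine Finset.card_biUnion_le_card_mul _ _ _ fun x _ => ?_
  split_ifs <;> exact Finset.card_le_two

lemma is2CNF_linking {N : ℕ} (hN : ∀ x ∈ Vars φ, x < N) : Is2CNF (linking φ τ₀ N) := by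
  classical
  intro C hC
  obtain ⟨x, hx, hC⟩ := Finset.mem_biUnion.1 hC
  have := hN x hx
  rw [isClause_and_card_eq_two_iff]
  split_ifs at hC <;> rcases Finset.mem_insert.1 hC with rfl | hC
  · exact ⟨x, x + N, _, _, by omega, rfl⟩
  · exact ⟨x, x + N, _, _, by omega, Finset.mem_singleton.1 hC⟩
  · exact ⟨x, _, _, _, by omega, rfl⟩
  · exact ⟨x, rep φ τ₀ x + N, _, _, by omega, Finset.mem_singleton.1 hC⟩

lemma satisfies_linking {N : ℕ} {σ : ℕ → Bool} :
    Satisfies σ (linking φ τ₀ N) ↔ ∀ x ∈ Vars φ,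
      (Forced φ τ₀ x → σ x = τ₀ x) ∧
      (¬ Forced φ τ₀ x → xor (σ x) (τ₀ x) = σ (rep φ τ₀ x + N)) := by
  classical
  have h : Satisfies σ (linking φ τ₀ N) ↔ ∀ x ∈ Vars φ, Satisfies σ
      (if Forced φ τ₀ x then {{(x, τ₀ x), (x + N, true)}, {(x, τ₀ x), (x + N, false)}}
      else {{(x, τ₀ x), (rep φ τ₀ x + N, true)}, {(x, !τ₀ x), (rep φ τ₀ x + N, false)}}) := by
    simp only [Satisfies, linking, Finset.mem_biUnion]
    exact ⟨fun h x hx C hC => h C ⟨x, hx, hC⟩, fun h C ⟨x, hx, hC⟩ => h x hx C hC⟩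
  rw [h]
  refine forall₂_congr fun x _ => ?_
  split_ifs with hf
  · simp only [Satisfies, Finset.forall_mem_insert, Finset.mem_singleton, forall_eq,
      exists_mem_pair_litTrue, hf]
    grind
  · simp only [Satisfies, Finset.forall_mem_insert, Finset.mem_singleton, forall_eq,
      exists_mem_pair_litTrue, hf]
    cases σ x <;> cases τ₀ x <;> cases σ (rep φ τ₀ x + N) <;> simp

lemma satisfies_of_reduced (hφ : Is2CNF φ) (hτ₀ : Satisfies τ₀ φ) {N : ℕ} {σ : ℕ → Bool}
    (hlink : Satisfies σ (linking φ τ₀ N))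
    (hred : Satisfies (fun u => σ (u + N)) (reduced φ τ₀)) : Satisfies σ φ := by
  classical
  rw [satisfies_linking] at hlink
  intro C hC
  have hV := fun l (hl : l ∈ C) => mem_Vars hC hl
  have hmod := fun τ (hτ : Satisfies τ φ) => hτ C hC
  obtain ⟨v, w, b, c, hvw, rfl⟩ := isClause_and_card_eq_two_iff.1 (hφ C hC)
  have hv : v ∈ Vars φ := hV (v, b) (by simp)
  have hw : w ∈ Vars φ := hV (w, c) (by simp)
  simp only [exists_mem_pair_litTrue] at hmod ⊢
  have h₀ := hmod _ hτ₀
  have lv := hlink v hv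
  have lw := hlink w hw
  by_cases hfv : Forced φ τ₀ v
  · by_cases hb : b = τ₀ v
    · exact Or.inl ((lv.1 hfv).trans hb.symm)
    · have hfw : Forced φ τ₀ w := fun τ hτ => by
        have := hmod τ hτ
        have := hfv τ hτ
        grind
      have := lw.1 hfw
      grind
  by_cases hfw : Forced φ τ₀ w
  · by_cases hc : c = τ₀ w
    · exact Or.inr ((lw.1 hfw).trans hc.symm)
    · refine absurd (fun τ hτ => ?_) hfv
      have := hmod τ hτ
      have := hfw τ hτ
      grind
  have lv := lv.2 hfv
  have lw := lw.2 hfw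
  by_cases hr : rep φ τ₀ v = rep φ τ₀ w
  · have ht : Tied φ τ₀ v w := fun τ hτ => by
      rw [(rep_spec hv).2 τ hτ, (rep_spec hw).2 τ hτ, hr]
    by_cases hbc : xor b (τ₀ v) = xor c (τ₀ w)
    · refine absurd (fun τ hτ => ?_) hfv
      have h₁ := hmod τ hτ
      have h₂ := ht τ hτ
      revert h₀ hbc h₁ h₂
      cases b <;> cases c <;> cases τ v <;> cases τ w <;> cases τ₀ v <;> cases τ₀ w <;> simp
    · rw [hr, ← lw] at lv
      revert hbc lv
      cases b <;> cases c <;> cases σ v <;> cases σ w <;> cases τ₀ v <;> cases τ₀ w <;> simp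
  · have hmem : ({((rep φ τ₀ v, xor b (τ₀ v)) : Lit), (rep φ τ₀ w, xor c (τ₀ w))} : Clause) ∈
        reduced φ τ₀ := by
      refine Finset.mem_filter.2 ⟨Finset.mem_image.2 ⟨_, Finset.mem_filter.2 ⟨hC, ?_⟩, ?_⟩,
        isClause_and_card_eq_two_iff.2 ⟨_, _, _, _, hr, rfl⟩⟩
      · simp [hfv, hfw]
      · simp [mapLit, Finset.image_insert]
    have := hred _ hmem
    simp only [exists_mem_pair_litTrue, ← lv, ← lw] at this
    simpa using this

/-- An encoding of the reduced formula yields one of the original formula, at the cost of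
two clauses per variable. -/
lemma exists_encoding_of_reduced (hφ : Is2CNF φ) (hτ₀ : Satisfies τ₀ φ) {ψ : Formula}
    (hψ : Is2CNF ψ) (henc : Encodes ψ (reduced φ τ₀) (Vars (reduced φ τ₀))) :
    ∃ φ' : Formula, Is2CNF φ' ∧ Encodes φ' φ (Vars φ) ∧
      φ'.card ≤ ψ.card + (Vars φ).card * 2 := by
  classical
  obtain ⟨N, hN⟩ : ∃ N, ∀ x ∈ Vars φ, x < N :=
    ⟨(Vars φ).sup id + 1, fun x hx => Nat.lt_succ_of_le (Finset.le_sup (f := id) hx)⟩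
  have hN' : ∀ u ∈ Vars (reduced φ τ₀), u < N := fun u hu =>
    hN u (mem_Vars_of_mem_Vars_reduced hu).1
  -- Auxiliary variables of `ψ` must avoid both `Vars φ` and its shifted copy.
  let g : ℕ → ℕ := fun u => if u ∈ Vars (reduced φ τ₀) then u + N else u + 2 * N
  have hg : Function.Injective g := by
    intro u v h
    have hu := hN' u
    have hv := hN' v
    simp only [g] at h
    split_ifs at h with h₁ h₂ h₂
    · omega
    · have := hu h₁; omega
    · have := hv h₂; omega
    · omega
  refine ⟨mapFormula g (fun _ => false) ψ ∪ linking φ τ₀ N,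
    (hψ.mapFormula hg _).union (is2CNF_linking hN), fun τ => ?_,
    (Finset.card_union_le _ _).trans
      (add_le_add Finset.card_image_le (card_linking_le N))⟩
  simp only [satisfies_union, satisfies_mapFormula, Bool.xor_false]
  constructor
  · intro hτ
    obtain ⟨ρ, hρ, hρψ⟩ := (henc _).1 (hτ.reduced (τ₀ := τ₀))
    let σ : ℕ → Bool := fun x =>
      if x < N then τ x
      else if x < 2 * N then xor (τ (x - N)) (τ₀ (x - N))
      else ρ (x - 2 * N)
    have hσ : ∀ x ∈ Vars φ, σ x = τ x := fun x hx => if_pos (hN x hx)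
    have hσ' : ∀ x < N, σ (x + N) = xor (τ x) (τ₀ x) := fun x hx => by
      simp only [σ]
      rw [if_neg (by omega), if_pos (by omega), Nat.add_sub_cancel]
    refine ⟨σ, hσ, ?_, ?_⟩
    · convert hρψ using 2 with u
      by_cases hu : u ∈ Vars (reduced φ τ₀)
      · simp only [g, if_pos hu]
        rw [hσ' u (hN' u hu), hρ u hu]
      · simp only [g, if_neg hu, σ]
        rw [if_neg (by omega), if_neg (by omega), Nat.add_sub_cancel]
    · rw [satisfies_linking]
      intro x hx
      obtain ⟨hr, ht⟩ := rep_spec (τ₀ := τ₀) hx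
      exact ⟨fun hf => (hσ x hx).trans (hf τ hτ), fun _ => by
        rw [hσ x hx, hσ' _ (hN _ hr), ht τ hτ]⟩
  · rintro ⟨σ, hσ, hmap, hlink⟩
    refine (satisfies_of_reduced hφ hτ₀ hlink ?_).congr hσ
    exact ((henc _).2 ⟨_, fun _ _ => rfl, hmap⟩).congr fun u hu => by simp only [g, if_pos hu]

end Reduction

lemma exists_unsatisfiable_2CNF :
    ∃ φ : Formula, Is2CNF φ ∧ (∀ σ, ¬ Satisfies σ φ) ∧ φ.card ≤ 4 := by
  refine ⟨{{(0, true), (1, true)}, {(0, true), (1, false)},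
    {(0, false), (1, true)}, {(0, false), (1, false)}}, ?_, ?_, Finset.card_le_four⟩
  · intro C hC
    simp only [Finset.mem_insert, Finset.mem_singleton] at hC
    rw [isClause_and_card_eq_two_iff]
    rcases hC with h | h | h | h <;> exact ⟨0, 1, _, _, zero_ne_one, h⟩
  · intro σ hσ
    simp only [Satisfies, Finset.forall_mem_insert, Finset.mem_singleton, forall_eq,
      exists_mem_pair_litTrue] at hσ
    cases h₀ : σ 0 <;> cases h₁ : σ 1 <;> simp_all

lemma card_Vars_pos_of_unsatisfiable {φ : Formula} (hφ : Is2CNF φ)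
    (h : ∀ τ, ¬ Satisfies τ φ) : 0 < (Vars φ).card := by
  obtain ⟨C, hC⟩ : φ.Nonempty := by
    rw [Finset.nonempty_iff_ne_empty]
    rintro rfl
    exact h (fun _ => false) (by simp [Satisfies])
  obtain ⟨l, hl⟩ : C.Nonempty := Finset.card_pos.1 (by rw [(hφ C hC).2]; norm_num)
  exact Finset.card_pos.2 ⟨_, mem_Vars hC hl⟩

/-- from simple 2-CNF encodings to general 2-CNF encodings with
linear overhead. -/
theorem simple_to_general (f : ℕ → ℕ)
    (hf : ∀ n : ℕ, ∀ φ : Formula, Is2CNF φ → IsSimple φ → (Vars φ).card ≤ n →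
      ∃ φ' : Formula, Is2CNF φ' ∧ Encodes φ' φ (Vars φ) ∧ φ'.card ≤ f n) :
    ∃ C : ℕ, ∀ n : ℕ, ∀ φ : Formula, Is2CNF φ → (Vars φ).card ≤ n →
      ∃ φ' : Formula, Is2CNF φ' ∧ Encodes φ' φ (Vars φ) ∧ φ'.card ≤ f n + C * n := by
  refine ⟨4, fun n φ hφ hn => ?_⟩
  by_cases hsat : ∃ τ₀, Satisfies τ₀ φ
  · obtain ⟨τ₀, hτ₀⟩ := hsat
    obtain ⟨ψ, hψ, henc, hcard⟩ := hf n _ is2CNF_reduced (isSimple_reduced hτ₀)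
      (card_Vars_reduced_le.trans hn)
    obtain ⟨φ', hφ', henc', hcard'⟩ := exists_encoding_of_reduced hφ hτ₀ hψ henc
    exact ⟨φ', hφ', henc', by omega⟩
  · push Not at hsat
    obtain ⟨φ', hφ', hunsat, hcard⟩ := exists_unsatisfiable_2CNF
    have := card_Vars_pos_of_unsatisfiable hφ hsat
    exact ⟨φ', hφ', fun τ => ⟨fun h => absurd h (hsat τ), fun ⟨σ, _, h⟩ => absurd h (hunsat σ)⟩,
      by omega⟩

end BVAPaper
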